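/- The 8×8 real symmetric matrix G determined by the Coxeter diagram D2, with entries G_{ii}=1 for all i; G_{12}=−1 (the facets 1 and 2 are parallel); G_{13}=G_{23}=G_{14}=G_{25}=−√(7/3); G_{36}=−√2; G_{45}=−1/2; G_{47}=−cos(π/4)=−√2/2; G_{58}=−√2/2; G_{67}=G_{68}=−1/2; G_{78}=−1/2; and all other off-diagonal entries 0, has signature (4,1) up to a 3-dimensional kernel, i.e., 4 positive eigenvalues, 1 negative eigenvalue, and 3 zero eigenvalues. -/

import Mathlib

open Real

/-- The Gram matrix of the Coxeter diagram `D₂` of the polytope `V`. -/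
noncomputable def gramD2 : Matrix (Fin 8) (Fin 8) ℝ :=
  let a : ℝ := Real.sqrt (7 / 3)
  let t : ℝ := Real.sqrt 2 / 2
  !![ 1, -1, -a, -a,    0,    0,    0,    0;
     -1,  1, -a,  0,   -a,    0,    0,    0;
     -a, -a,  1,  0,    0, -Real.sqrt 2, 0, 0;
     -a,  0,  0,  1, -1/2,    0,   -t,    0;
      0, -a,  0, -1/2,  1,    0,    0,   -t;
      0,  0, -Real.sqrt 2, 0, 0,    1, -1/2, -1/2;
      0,  0,  0, -t,    0, -1/2,    1, -1/2;
      0,  0,  0,  0,   -t, -1/2, -1/2,    1]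

open scoped Matrix

/-- A linear system in `E` whose equations are indexed by `{i // p i}` and which has only the zero
solution has at least `finrank E` equations. -/
theorem finrank_le_card_of_forall_dotProduct_eq_zero {n E : Type*} [Fintype n] [AddCommGroup E]
    [Module ℝ E] (v : n → n → ℝ) (f : E →ₗ[ℝ] n → ℝ) (p : n → Prop)
    (h : ∀ x, (∀ i, p i → v i ⬝ᵥ f x = 0) → x = 0) :
    Module.finrank ℝ E ≤ Nat.card {i // p i} := by
  classical
  let g : E →ₗ[ℝ] ({i // p i} → ℝ) :=
    { toFun := fun x i => v i ⬝ᵥ f x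
      map_add' := fun x y => by ext i; simp [dotProduct_add]
      map_smul' := fun c x => by ext i; simp [dotProduct_smul] }
  have hg : Function.Injective g := by
    refine (injective_iff_map_eq_zero g).2 fun x hx => h x fun i hi => ?_
    exact congrFun hx ⟨i, hi⟩
  have := LinearMap.finrank_le_finrank_of_injective hg
  rwa [Module.finrank_fintype_fun_eq_card, ← Nat.card_eq_fintype_card] at this

namespace Matrix.IsHermitian

variable {n : Type*} [Fintype n] [DecidableEq n] {A : Matrix n n ℝ}

theorem eigenvectorBasis_dotProduct_mulVec (hA : A.IsHermitian) (i : n) (w : n → ℝ) :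
    (hA.eigenvectorBasis i).ofLp ⬝ᵥ (A *ᵥ w) =
      hA.eigenvalues i * ((hA.eigenvectorBasis i).ofLp ⬝ᵥ w) := by
  have hT : Aᵀ = A := by simpa [Matrix.IsHermitian, conjTranspose_eq_transpose_of_trivial] using hA
  rw [dotProduct_mulVec, ← mulVec_transpose, hT, hA.mulVec_eigenvectorBasis, smul_dotProduct,
    smul_eq_mul]

theorem dotProduct_eq_sum_eigenvectorBasis (hA : A.IsHermitian) (w u : n → ℝ) :
    w ⬝ᵥ u = ∑ i, ((hA.eigenvectorBasis i).ofLp ⬝ᵥ w) * ((hA.eigenvectorBasis i).ofLp ⬝ᵥ u) := by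
  have := hA.eigenvectorBasis.sum_inner_mul_inner (WithLp.toLp 2 w) (WithLp.toLp 2 u)
  simp only [EuclideanSpace.inner_eq_star_dotProduct, star_trivial] at this
  rw [dotProduct_comm w u, ← this]
  exact Finset.sum_congr rfl fun i _ => by rw [dotProduct_comm u]

theorem dotProduct_mulVec_eq_sum (hA : A.IsHermitian) (w : n → ℝ) :
    w ⬝ᵥ (A *ᵥ w) =
      ∑ i, hA.eigenvalues i * ((hA.eigenvectorBasis i).ofLp ⬝ᵥ w) ^ 2 := by
  rw [hA.dotProduct_eq_sum_eigenvectorBasis]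
  exact Finset.sum_congr rfl fun i _ => by rw [hA.eigenvectorBasis_dotProduct_mulVec]; ring

variable {E : Type*} [AddCommGroup E] [Module ℝ E]

theorem finrank_le_card_eigenvalues_pos (hA : A.IsHermitian) (f : E →ₗ[ℝ] n → ℝ)
    (h : ∀ x, x ≠ 0 → 0 < f x ⬝ᵥ (A *ᵥ f x)) :
    Module.finrank ℝ E ≤ Nat.card {i // 0 < hA.eigenvalues i} := by
  refine finrank_le_card_of_forall_dotProduct_eq_zero
    (fun i => (hA.eigenvectorBasis i).ofLp) f _ fun x hx => ?_
  by_contra hne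
  refine (h x hne).not_ge ?_
  rw [hA.dotProduct_mulVec_eq_sum]
  refine Finset.sum_nonpos fun i _ => ?_
  by_cases hi : 0 < hA.eigenvalues i
  · simp [hx i hi]
  · exact mul_nonpos_of_nonpos_of_nonneg (not_lt.1 hi) (sq_nonneg _)

theorem finrank_le_card_eigenvalues_neg (hA : A.IsHermitian) (f : E →ₗ[ℝ] n → ℝ)
    (h : ∀ x, x ≠ 0 → f x ⬝ᵥ (A *ᵥ f x) < 0) :
    Module.finrank ℝ E ≤ Nat.card {i // hA.eigenvalues i < 0} := by
  refine finrank_le_card_of_forall_dotProduct_eq_zero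
    (fun i => (hA.eigenvectorBasis i).ofLp) f _ fun x hx => ?_
  by_contra hne
  refine (h x hne).not_ge ?_
  rw [hA.dotProduct_mulVec_eq_sum]
  refine Finset.sum_nonneg fun i _ => ?_
  by_cases hi : hA.eigenvalues i < 0
  · simp [hx i hi]
  · exact mul_nonneg (not_lt.1 hi) (sq_nonneg _)

theorem finrank_le_card_eigenvalues_eq_zero (hA : A.IsHermitian) (f : E →ₗ[ℝ] n → ℝ)
    (hf : ∀ x, f x = 0 → x = 0) (h : ∀ x, A *ᵥ f x = 0) :
    Module.finrank ℝ E ≤ Nat.card {i // hA.eigenvalues i = 0} := by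
  refine finrank_le_card_of_forall_dotProduct_eq_zero
    (fun i => (hA.eigenvectorBasis i).ofLp) f _ fun x hx => hf x ?_
  rw [← dotProduct_self_eq_zero, hA.dotProduct_eq_sum_eigenvectorBasis]
  refine Finset.sum_eq_zero fun i _ => ?_
  by_cases hi : hA.eigenvalues i = 0
  · simp [hx i hi]
  · have := hA.eigenvectorBasis_dotProduct_mulVec i (f x)
    rw [h, dotProduct_zero, eq_comm, mul_eq_zero] at this
    simp [this.resolve_left hi]

end Matrix.IsHermitian

theorem Nat.card_pos_add_card_neg_add_card_eq_zero {ι : Type*} [Fintype ι] (g : ι → ℝ) :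
    Nat.card {i // 0 < g i} + Nat.card {i // g i < 0} + Nat.card {i // g i = 0} =
      Fintype.card ι := by
  classical
  simp only [Nat.card_eq_fintype_card, Fintype.card_subtype, Finset.card_filter,
    ← Finset.sum_add_distrib]
  rw [Finset.sum_congr rfl (g := fun _ => 1), Finset.sum_const, smul_eq_mul, mul_one,
    Finset.card_univ]
  intro i _
  rcases lt_trichotomy (g i) 0 with h | h | h
  · simp [h, h.ne, h.not_gt]
  · simp [h]
  · simp [h, h.ne', h.not_gt]

/-- The coordinate embedding onto the facets `4, 5, 6, 7`, which span a subdiagram of type `F₄`. -/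
def embedF4 : (Fin 4 → ℝ) →ₗ[ℝ] (Fin 8 → ℝ) :=
  (!![0, 0, 0, 0; 0, 0, 0, 0; 0, 0, 0, 0; 1, 0, 0, 0; 0, 1, 0, 0; 0, 0, 1, 0; 0, 0, 0, 1;
    0, 0, 0, 0] : Matrix (Fin 8) (Fin 4) ℝ).mulVecLin

theorem gramD2_pos_on_embedF4 (x : Fin 4 → ℝ) (hx : x ≠ 0) :
    0 < embedF4 x ⬝ᵥ (gramD2 *ᵥ embedF4 x) := by
  have h2 : √2 ^ 2 = (2 : ℝ) := Real.sq_sqrt (by norm_num)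
  have hform : embedF4 x ⬝ᵥ (gramD2 *ᵥ embedF4 x) =
      (x 1 - x 0 / 2) ^ 2 + (x 2 - x 3 / 2) ^ 2 + 3 / 4 * (x 0 - 2 * √2 / 3 * x 3) ^ 2 +
        1 / 12 * x 3 ^ 2 := by
    simp [embedF4, gramD2, Matrix.mulVec, dotProduct, Fin.sum_univ_succ]
    linear_combination (-(x 3) ^ 2 / 3) * h2
  rw [hform]
  by_contra! hle
  have h3 : x 3 = 0 := by
    refine pow_eq_zero_iff two_ne_zero |>.1 (le_antisymm ?_ (sq_nonneg _))
    nlinarith [sq_nonneg (x 1 - x 0 / 2), sq_nonneg (x 2 - x 3 / 2),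
      sq_nonneg (x 0 - 2 * √2 / 3 * x 3)]
  simp only [h3, mul_zero, sub_zero, zero_div] at hle
  have h0 : x 0 = 0 := by
    refine pow_eq_zero_iff two_ne_zero |>.1 (le_antisymm ?_ (sq_nonneg _))
    nlinarith [sq_nonneg (x 1 - x 0 / 2), sq_nonneg (x 2)]
  simp only [h0, sub_zero, zero_div] at hle
  have h1 : x 1 = 0 := by
    refine pow_eq_zero_iff two_ne_zero |>.1 (le_antisymm ?_ (sq_nonneg _))
    nlinarith [sq_nonneg (x 2)]
  have h2' : x 2 = 0 := by
    refine pow_eq_zero_iff two_ne_zero |>.1 (le_antisymm ?_ (sq_nonneg _))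
    nlinarith [sq_nonneg (x 1)]
  exact hx (by ext i; fin_cases i <;> simp [h0, h1, h2', h3])

/-- The line spanned by the sum of the normals of the facets `1, 2, 3`. -/
def timelikeLine : (Fin 1 → ℝ) →ₗ[ℝ] (Fin 8 → ℝ) :=
  (!![1; 1; 1; 0; 0; 0; 0; 0] : Matrix (Fin 8) (Fin 1) ℝ).mulVecLin

theorem gramD2_neg_on_timelikeLine (x : Fin 1 → ℝ) (hx : x ≠ 0) :
    timelikeLine x ⬝ᵥ (gramD2 *ᵥ timelikeLine x) < 0 := by
  have h0 : x 0 ≠ 0 := fun h => hx (by ext i; fin_cases i; simpa using h)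
  have ha : 1 < √(7 / 3 : ℝ) := Real.lt_sqrt_of_sq_lt (by norm_num)
  have hform : timelikeLine x ⬝ᵥ (gramD2 *ᵥ timelikeLine x) =
      (1 - 4 * √(7 / 3)) * x 0 ^ 2 := by
    simp [timelikeLine, gramD2, Matrix.mulVec, dotProduct, Fin.sum_univ_succ,
      -Real.sqrt_div, -Real.sqrt_div']
    ring
  rw [hform]
  exact mul_neg_of_neg_of_pos (by linarith) (by positivity)

/-- A parametrization of the kernel of `gramD2`. -/
noncomputable def kernelMap : (Fin 3 → ℝ) →ₗ[ℝ] (Fin 8 → ℝ) :=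
  (!![-(3 * √(7 / 3) / 14), -(3 * √(7 / 3) / 14 * √2), √(7 / 3) / 2;
      -(3 * √(7 / 3) / 14), -(3 * √(7 / 3) / 14 * √2), -(√(7 / 3) / 2);
      -1, 0, 0;
      1, 0, 1;
      1, 0, -1;
      0, 1, 0;
      √2, 1, √2 / 3;
      √2, 1, -(√2 / 3)] : Matrix (Fin 8) (Fin 3) ℝ).mulVecLin

theorem kernelMap_eq_zero (x : Fin 3 → ℝ) (h : kernelMap x = 0) : x = 0 := by
  have e2 := congrFun h 2
  have e3 := congrFun h 3
  have e5 := congrFun h 5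
  simp [kernelMap, Matrix.mulVec, dotProduct, Fin.sum_univ_succ] at e2 e3 e5
  ext i
  fin_cases i
  · exact e2
  · exact e5
  · simpa [e2] using e3

theorem gramD2_mulVec_kernelMap (x : Fin 3 → ℝ) : gramD2 *ᵥ kernelMap x = 0 := by
  have h2 : √2 ^ 2 = (2 : ℝ) := Real.sq_sqrt (by norm_num)
  have ha : √(7 / 3) ^ 2 = (7 / 3 : ℝ) := Real.sq_sqrt (by norm_num)
  unfold gramD2 kernelMap
  generalize √(7 / 3 : ℝ) = a at *
  generalize √(2 : ℝ) = s at *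
  ext i
  fin_cases i <;> simp [Matrix.mulVec, dotProduct, Fin.sum_univ_succ] <;> grind

/-- The Gram matrix of `D₂` has signature `(4,1,3)`: 4 positive eigenvalues,
1 negative eigenvalue and 3 zero eigenvalues. -/
theorem stmt_8 (hG : gramD2.IsHermitian) :
    Nat.card {i : Fin 8 // 0 < hG.eigenvalues i} = 4 ∧
    Nat.card {i : Fin 8 // hG.eigenvalues i < 0} = 1 ∧
    Nat.card {i : Fin 8 // hG.eigenvalues i = 0} = 3 := by
  have hpos := hG.finrank_le_card_eigenvalues_pos embedF4 gramD2_pos_on_embedF4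
  have hneg := hG.finrank_le_card_eigenvalues_neg timelikeLine gramD2_neg_on_timelikeLine
  have hzero := hG.finrank_le_card_eigenvalues_eq_zero kernelMap kernelMap_eq_zero
    gramD2_mulVec_kernelMap
  have hsum := Nat.card_pos_add_card_neg_add_card_eq_zero hG.eigenvalues
  rw [Module.finrank_fin_fun] at hpos hneg hzero
  rw [Fintype.card_fin] at hsum
  omega
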